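/- For Lie superalgebras H and K over a field F (char F ≠ 2,3), there is an isomorphism (H ⊕ K) ∧ (H ⊕ K) ≅ (H ∧ H) ⊕ (K ∧ K) ⊕ (H/H' ⊗ K/K'), where H' = [H,H], K' = [K,K], and H/H' ⊗ K/K' is the tensor product of the abelian Lie superalgebras H/H' and K/K' (with trivial mutual actions). -/

import Mathlib

/-!
Common definitions: Lie superalgebras over a field `F` (char ≠ 2,3 where needed),
graded ideals, centers, capability, epicenter, non-abelian tensor and exterior
products (characterized by generators-and-relations universal properties),
free Lie superalgebras, Schur multipliers, Heisenberg Lie superalgebras, etc.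
-/

namespace SuperLie

open Submodule Function Module

universe u v w

/-- The sign `(-1)^{|a||b|}` attached to a pair of `ℤ₂`-degrees. -/
def sg (F : Type u) [Field F] (a b : ZMod 2) : F := (-1 : F) ^ (a.val * b.val)

/-- A Lie superalgebra over `F`: a `ℤ₂`-graded vector space `L = L₀ ⊕ L₁`
together with an even bilinear bracket satisfying graded skew-symmetry and the
graded Jacobi identity (on homogeneous elements). -/
class LieSuper (F : Type u) [Field F] (L : Type v) [AddCommGroup L] [Module F L] where
  gr : ZMod 2 → Submodule F L
  isCompl_gr : IsCompl (gr 0) (gr 1)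
  br : L → L → L
  br_add_left : ∀ x y z : L, br (x + y) z = br x z + br y z
  br_add_right : ∀ x y z : L, br x (y + z) = br x y + br x z
  br_smul_left : ∀ (c : F) (x y : L), br (c • x) y = c • br x y
  br_smul_right : ∀ (c : F) (x y : L), br x (c • y) = c • br x y
  br_gr : ∀ a b : ZMod 2, ∀ x ∈ gr a, ∀ y ∈ gr b, br x y ∈ gr (a + b)
  br_skew : ∀ a b : ZMod 2, ∀ x ∈ gr a, ∀ y ∈ gr b, br x y = -(sg F a b) • br y x
  br_jacobi : ∀ a b c : ZMod 2, ∀ x ∈ gr a, ∀ y ∈ gr b, ∀ z ∈ gr c,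
    sg F a c • br x (br y z) + sg F b a • br y (br z x) + sg F c b • br z (br x y) = 0

/-- The `a`-graded piece of a Lie superalgebra. -/
def grd (F : Type u) [Field F] (L : Type v) [AddCommGroup L] [Module F L] [LieSuper F L]
    (a : ZMod 2) : Submodule F L :=
  LieSuper.gr a

/-- The bracket of a Lie superalgebra. -/
def sbr (F : Type u) [Field F] {L : Type v} [AddCommGroup L] [Module F L] [LieSuper F L]
    (x y : L) : L :=
  LieSuper.br (F := F) x y

/-- The center `Z(L) = {z ∈ L : [z,x] = 0 for all x ∈ L}`. -/
def centerS (F : Type u) [Field F] (L : Type v) [AddCommGroup L] [Module F L] [LieSuper F L] :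
    Submodule F L where
  carrier := {z : L | ∀ x : L, sbr F z x = 0}
  add_mem' := by
    intro a b ha hb x
    simp only [Set.mem_setOf_eq, sbr] at ha hb ⊢
    rw [LieSuper.br_add_left, ha x, hb x, add_zero]
  zero_mem' := by
    intro x
    have h := LieSuper.br_smul_left (F := F) (0 : F) (0 : L) x
    simp only [Set.mem_setOf_eq, sbr, zero_smul] at h ⊢
    simpa using h
  smul_mem' := by
    intro c a ha x
    simp only [Set.mem_setOf_eq, sbr] at ha ⊢
    rw [LieSuper.br_smul_left, ha x, smul_zero]

/-- Homomorphisms of Lie superalgebras: even (grading preserving) linear maps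
which preserve the bracket. -/
def IsHom (F : Type u) [Field F] {L : Type v} {M : Type w}
    [AddCommGroup L] [Module F L] [LieSuper F L]
    [AddCommGroup M] [Module F M] [LieSuper F M] (f : L →ₗ[F] M) : Prop :=
  (∀ a : ZMod 2, ∀ x ∈ grd F L a, f x ∈ grd F M a) ∧
  (∀ x y : L, f (sbr F x y) = sbr F (f x) (f y))

/-- A bundled Lie superalgebra over `F`. -/
structure LieSupAlg (F : Type u) [Field F] : Type (max u (v + 1)) where
  carrier : Type v
  [iag : AddCommGroup carrier]
  [imo : Module F carrier]
  [ils : LieSuper F carrier]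

attribute [instance] LieSupAlg.iag LieSupAlg.imo LieSupAlg.ils

instance (F : Type u) [Field F] : CoeSort (LieSupAlg.{u, v} F) (Type v) :=
  ⟨LieSupAlg.carrier⟩

/-- A Lie superalgebra `L` is capable if `L ≅ H/Z(H)` for some Lie superalgebra `H`,
i.e. there is a surjective homomorphism onto `L` whose kernel is exactly the center. -/
def Capable (F : Type u) [Field F] (L : Type v) [AddCommGroup L] [Module F L]
    [LieSuper F L] : Prop :=
  ∃ (H : LieSupAlg.{u, max u v} F) (φ : H.carrier →ₗ[F] L),
    IsHom F φ ∧ Surjective φ ∧ LinearMap.ker φ = centerS F H.carrier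

/-- Graded ideals of a Lie superalgebra. -/
def IsGIdeal (F : Type u) [Field F] {L : Type v} [AddCommGroup L] [Module F L]
    [LieSuper F L] (I : Submodule F L) : Prop :=
  (∀ x ∈ I, ∀ y : L, sbr F x y ∈ I) ∧ (∀ y : L, ∀ x ∈ I, sbr F y x ∈ I) ∧
  (∀ x ∈ I, ∃ x0 ∈ I ⊓ grd F L 0, ∃ x1 ∈ I ⊓ grd F L 1, x = x0 + x1)

/-- The graded ideal generated by a subset. -/
def idealClosure (F : Type u) [Field F] {L : Type v} [AddCommGroup L] [Module F L]
    [LieSuper F L] (S : Set L) : Submodule F L :=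
  sInf {I : Submodule F L | IsGIdeal F I ∧ S ⊆ ↑I}

/-- `QuotCapable F L N` expresses that the quotient Lie superalgebra `L/N` is capable. -/
def QuotCapable (F : Type u) [Field F] (L : Type v) [AddCommGroup L] [Module F L]
    [LieSuper F L] (N : Submodule F L) : Prop :=
  ∃ (Q : LieSupAlg.{u, max u v} F) (π : L →ₗ[F] Q.carrier),
    IsHom F π ∧ Surjective π ∧ LinearMap.ker π = N ∧ Capable F Q.carrier

/-- The epicenter `Z^*(L)`: the smallest graded ideal of `L` such that the
corresponding quotient is capable. -/
def IsEpicenter (F : Type u) [Field F] (L : Type v) [AddCommGroup L] [Module F L]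
    [LieSuper F L] (Z : Submodule F L) : Prop :=
  IsGIdeal F Z ∧ QuotCapable F L Z ∧
  ∀ N : Submodule F L, IsGIdeal F N → QuotCapable F L N → Z ≤ N

/-- The submodule `[I,J]` spanned by brackets. -/
def bracketSpan (F : Type u) [Field F] {L : Type v} [AddCommGroup L] [Module F L]
    [LieSuper F L] (I J : Submodule F L) : Submodule F L :=
  Submodule.span F {z : L | ∃ x ∈ I, ∃ y ∈ J, z = sbr F x y}

/-- The derived subalgebra `L' = [L,L]`. -/
def derived (F : Type u) [Field F] (L : Type v) [AddCommGroup L] [Module F L]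
    [LieSuper F L] : Submodule F L :=
  bracketSpan F (⊤ : Submodule F L) ⊤

/-- The lower central series of a Lie superalgebra. -/
def lowerCentral (F : Type u) [Field F] (L : Type v) [AddCommGroup L] [Module F L]
    [LieSuper F L] : ℕ → Submodule F L
  | 0 => ⊤
  | n + 1 => bracketSpan F (lowerCentral F L n) ⊤

/-- A Lie superalgebra is nilpotent if its lower central series terminates at zero. -/
def IsNilp (F : Type u) [Field F] (L : Type v) [AddCommGroup L] [Module F L]
    [LieSuper F L] : Prop :=
  ∃ n : ℕ, lowerCentral F L n = ⊥

/-- An action of a Lie superalgebra `P` on a Lie superalgebra `M`: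
an even bilinear map satisfying the two action axioms. -/
structure IsAction (F : Type u) [Field F] {P : Type v} {M : Type v}
    [AddCommGroup P] [Module F P] [LieSuper F P]
    [AddCommGroup M] [Module F M] [LieSuper F M] (act : P → M → M) : Prop where
  add_left : ∀ (p q : P) (m : M), act (p + q) m = act p m + act q m
  add_right : ∀ (p : P) (m m' : M), act p (m + m') = act p m + act p m'
  smul_left : ∀ (c : F) (p : P) (m : M), act (c • p) m = c • act p m
  smul_right : ∀ (c : F) (p : P) (m : M), act p (c • m) = c • act p m
  grade : ∀ a b : ZMod 2, ∀ p ∈ grd F P a, ∀ m ∈ grd F M b, act p m ∈ grd F M (a + b)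
  br_act : ∀ a b : ZMod 2, ∀ p ∈ grd F P a, ∀ p' ∈ grd F P b, ∀ m : M,
    act (sbr F p p') m = act p (act p' m) - sg F a b • act p' (act p m)
  act_br : ∀ a b : ZMod 2, ∀ p ∈ grd F P a, ∀ m ∈ grd F M b, ∀ m' : M,
    act p (sbr F m m') = sbr F (act p m) m' + sg F a b • sbr F m (act p m')

/-- Compatibility of mutual actions of two Lie superalgebras on each other. -/
def Compatible (F : Type u) [Field F] {M : Type v} {N : Type v}
    [AddCommGroup M] [Module F M] [LieSuper F M]
    [AddCommGroup N] [Module F N] [LieSuper F N]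
    (actMN : M → N → N) (actNM : N → M → M) : Prop :=
  (∀ a b : ZMod 2, ∀ m ∈ grd F M a, ∀ n ∈ grd F N b, ∀ n' : N,
      actMN (actNM n m) n' = -(sg F a b) • sbr F (actMN m n) n') ∧
  (∀ a b : ZMod 2, ∀ m ∈ grd F M a, ∀ n ∈ grd F N b, ∀ m' : M,
      actNM (actMN m n) m' = -(sg F a b) • sbr F (actNM n m) m')

/-- The defining relations of the non-abelian tensor product `M ⊗ N` of Lie
superalgebras (with given mutual actions), satisfied by a pairing `q` into `T`. -/
structure TensorRel (F : Type u) [Field F] {M : Type v} {N : Type v} {T : Type w}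
    [AddCommGroup M] [Module F M] [LieSuper F M]
    [AddCommGroup N] [Module F N] [LieSuper F N]
    [AddCommGroup T] [Module F T] [LieSuper F T]
    (actMN : M → N → N) (actNM : N → M → M) (q : M → N → T) : Prop where
  add_left : ∀ (m m' : M) (n : N), q (m + m') n = q m n + q m' n
  add_right : ∀ (m : M) (n n' : N), q m (n + n') = q m n + q m n'
  smul_left : ∀ (c : F) (m : M) (n : N), q (c • m) n = c • q m n
  smul_right : ∀ (c : F) (m : M) (n : N), q m (c • n) = c • q m n
  grade : ∀ a b : ZMod 2, ∀ m ∈ grd F M a, ∀ n ∈ grd F N b, q m n ∈ grd F T (a + b)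
  brk_left : ∀ a b : ZMod 2, ∀ m ∈ grd F M a, ∀ m' ∈ grd F M b, ∀ n : N,
    q (sbr F m m') n = q m (actMN m' n) - sg F a b • q m' (actMN m n)
  brk_right : ∀ a b c : ZMod 2, ∀ m ∈ grd F M a, ∀ n ∈ grd F N b, ∀ n' ∈ grd F N c,
    q m (sbr F n n') = sg F c (a + b) • q (actNM n' m) n - sg F a b • q (actNM n m) n'
  brk_brk : ∀ a b : ZMod 2, ∀ m ∈ grd F M a, ∀ n ∈ grd F N b, ∀ (m' : M) (n' : N),
    sbr F (q m n) (q m' n') = -(sg F a b) • q (actNM n m) (actMN m' n')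

/-- `IsTensorObj F actMN actNM t` says that `(T, t)` is the non-abelian tensor
product `M ⊗ N`: the pairing `t` satisfies the defining relations and is
universal among all pairings satisfying them. -/
structure IsTensorObj (F : Type u) [Field F] {M : Type v} {N : Type v} {T : Type v}
    [AddCommGroup M] [Module F M] [LieSuper F M]
    [AddCommGroup N] [Module F N] [LieSuper F N]
    [AddCommGroup T] [Module F T] [LieSuper F T]
    (actMN : M → N → N) (actNM : N → M → M) (t : M → N → T) : Prop where
  rel : TensorRel F actMN actNM t
  lift : ∀ (Q : LieSupAlg.{u, max u v} F) (q : M → N → Q.carrier),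
    TensorRel F actMN actNM q →
    ∃! h : T →ₗ[F] Q.carrier, IsHom F h ∧ ∀ (m : M) (n : N), h (t m n) = q m n

/-- The defining relations of the non-abelian exterior square `L ∧ L` of a Lie
superalgebra (the tensor relations for the bracket actions, together with the
graded alternating relations coming from `L □ L`). -/
structure ExtRel (F : Type u) [Field F] {L : Type v} {T : Type w}
    [AddCommGroup L] [Module F L] [LieSuper F L]
    [AddCommGroup T] [Module F T] [LieSuper F T] (q : L → L → T) : Prop where
  toTensor : TensorRel F (fun x y : L => sbr F x y) (fun x y : L => sbr F x y) q
  alt : ∀ a b : ZMod 2, ∀ x ∈ grd F L a, ∀ y ∈ grd F L b, q x y = -(sg F a b) • q y x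
  alt_even : ∀ x ∈ grd F L 0, q x x = 0

/-- `IsExtObj F t` says that `(E, t)` is the non-abelian exterior square `L ∧ L`. -/
structure IsExtObj (F : Type u) [Field F] {L : Type v} {E : Type v}
    [AddCommGroup L] [Module F L] [LieSuper F L]
    [AddCommGroup E] [Module F E] [LieSuper F E] (t : L → L → E) : Prop where
  rel : ExtRel F t
  lift : ∀ (Q : LieSupAlg.{u, max u v} F) (q : L → L → Q.carrier),
    ExtRel F q →
    ∃! h : E →ₗ[F] Q.carrier, IsHom F h ∧ ∀ x y : L, h (t x y) = q x y

/-- A free Lie superalgebra: free on some `ℤ₂`-graded subset `X`. -/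
def IsFreeLieSuper (F : Type u) [Field F] (Fr : Type v) [AddCommGroup Fr] [Module F Fr]
    [LieSuper F Fr] : Prop :=
  ∃ X : ZMod 2 → Set Fr,
    (∀ a : ZMod 2, X a ⊆ (grd F Fr a : Set Fr)) ∧
    ∀ (Q : LieSupAlg.{u, max u v} F) (f : ∀ a : ZMod 2, X a → Q.carrier),
      (∀ (a : ZMod 2) (x : X a), f a x ∈ grd F Q.carrier a) →
      ∃! h : Fr →ₗ[F] Q.carrier,
        IsHom F h ∧ ∀ (a : ZMod 2) (x : X a), h (x : Fr) = f a x

/-- `F' ∩ R`, for a free presentation with kernel `R`. -/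
abbrev schurA (F : Type u) [Field F] (Fr : Type v) [AddCommGroup Fr] [Module F Fr]
    [LieSuper F Fr] (R : Submodule F Fr) : Submodule F Fr :=
  derived F Fr ⊓ R

/-- The Schur multiplier `M(L) = (F' ∩ R)/[R,F]` attached to a free presentation
`0 → R → F → L → 0`. -/
abbrev SchurMul (F : Type u) [Field F] (Fr : Type v) [AddCommGroup Fr] [Module F Fr]
    [LieSuper F Fr] (R : Submodule F Fr) :=
  ↥(schurA F Fr R) ⧸ (Submodule.comap (schurA F Fr R).subtype (bracketSpan F R ⊤))

/-- `L` is (isomorphic to) the special Heisenberg Lie superalgebra `H(m,n)` with even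
center: basis `x₁,…,x_{2m}, z` (even), `y₁,…,y_n` (odd), with `[xᵢ, x_{m+i}] = z`,
`[y_j, y_j] = z` and `z` central. -/
def IsHeisE (F : Type u) [Field F] (m n : ℕ) (L : Type v) [AddCommGroup L] [Module F L]
    [LieSuper F L] : Prop :=
  ∃ (x : Fin (2 * m) → L) (y : Fin n → L) (z : L),
    (∀ i, x i ∈ grd F L 0) ∧ z ∈ grd F L 0 ∧ (∀ j, y j ∈ grd F L 1) ∧
    LinearIndependent F (Sum.elim x (Sum.elim y (fun _ : Unit => z))) ∧
    Submodule.span F (Set.range (Sum.elim x (Sum.elim y (fun _ : Unit => z)))) = ⊤ ∧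
    (∀ i j : Fin (2 * m), sbr F (x i) (x j) =
      if (j : ℕ) = (i : ℕ) + m then z else if (i : ℕ) = (j : ℕ) + m then -z else 0) ∧
    (∀ (i : Fin (2 * m)) (j : Fin n), sbr F (x i) (y j) = 0) ∧
    (∀ (i : Fin (2 * m)) (j : Fin n), sbr F (y j) (x i) = 0) ∧
    (∀ i j : Fin n, sbr F (y i) (y j) = if i = j then z else 0) ∧
    (∀ w : L, sbr F z w = 0) ∧ (∀ w : L, sbr F w z = 0)

/-- `L` is (isomorphic to) the Heisenberg Lie superalgebra `H_m` with odd center: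
basis `x₁,…,x_m` (even), `y₁,…,y_m, z` (odd), with `[x_j, y_j] = z` and `z` central. -/
def IsHeisO (F : Type u) [Field F] (m : ℕ) (L : Type v) [AddCommGroup L] [Module F L]
    [LieSuper F L] : Prop :=
  ∃ (x : Fin m → L) (y : Fin m → L) (z : L),
    (∀ i, x i ∈ grd F L 0) ∧ (∀ j, y j ∈ grd F L 1) ∧ z ∈ grd F L 1 ∧
    LinearIndependent F (Sum.elim x (Sum.elim y (fun _ : Unit => z))) ∧
    Submodule.span F (Set.range (Sum.elim x (Sum.elim y (fun _ : Unit => z)))) = ⊤ ∧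
    (∀ i j : Fin m, sbr F (x i) (x j) = 0) ∧
    (∀ i j : Fin m, sbr F (x i) (y j) = if i = j then z else 0) ∧
    (∀ i j : Fin m, sbr F (y j) (x i) = if i = j then -z else 0) ∧
    (∀ i j : Fin m, sbr F (y i) (y j) = 0) ∧
    (∀ w : L, sbr F z w = 0) ∧ (∀ w : L, sbr F w z = 0)

/-- `A` is (isomorphic to) the abelian Lie superalgebra `A(r | s)` of
superdimension `(r | s)`. -/
def IsAbelSuper (F : Type u) [Field F] (r s : ℕ) (A : Type v) [AddCommGroup A]
    [Module F A] [LieSuper F A] : Prop :=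
  (∀ x y : A, sbr F x y = 0) ∧ Module.Finite F A ∧
  Module.finrank F ↥(grd F A 0) = r ∧ Module.finrank F ↥(grd F A 1) = s

/-- The direct sum (product) of two Lie superalgebras. -/
instance prodLieSuper (F : Type u) [Field F] (A : Type v) (B : Type w)
    [AddCommGroup A] [Module F A] [LieSuper F A]
    [AddCommGroup B] [Module F B] [LieSuper F B] : LieSuper F (A × B) where
  gr a := (grd F A a).prod (grd F B a)
  isCompl_gr := by
    have hA : IsCompl (grd F A 0) (grd F A 1) := LieSuper.isCompl_gr
    have hB : IsCompl (grd F B 0) (grd F B 1) := LieSuper.isCompl_gr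
    constructor
    · rw [disjoint_iff, eq_bot_iff]
      rintro ⟨a, b⟩ h
      rw [Submodule.mem_inf] at h
      obtain ⟨h0, h1⟩ := h
      rw [Submodule.mem_prod] at h0 h1
      have ha : a = 0 := by
        have := hA.disjoint.le_bot (Submodule.mem_inf.mpr ⟨h0.1, h1.1⟩)
        simpa using this
      have hb : b = 0 := by
        have := hB.disjoint.le_bot (Submodule.mem_inf.mpr ⟨h0.2, h1.2⟩)
        simpa using this
      simp [ha, hb, Prod.ext_iff]
    · rw [codisjoint_iff, eq_top_iff]
      rintro ⟨a, b⟩ -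
      have ha' : a ∈ grd F A 0 ⊔ grd F A 1 := by
        rw [hA.codisjoint.eq_top]; trivial
      have hb' : b ∈ grd F B 0 ⊔ grd F B 1 := by
        rw [hB.codisjoint.eq_top]; trivial
      obtain ⟨a0, ha0, a1, ha1, rfl⟩ := Submodule.mem_sup.mp ha'
      obtain ⟨b0, hb0, b1, hb1, rfl⟩ := Submodule.mem_sup.mp hb'
      refine Submodule.mem_sup.mpr ⟨(a0, b0), ?_, (a1, b1), ?_, ?_⟩
      · exact Submodule.mem_prod.mpr ⟨ha0, hb0⟩
      · exact Submodule.mem_prod.mpr ⟨ha1, hb1⟩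
      · rfl
  br x y := (sbr F x.1 y.1, sbr F x.2 y.2)
  br_add_left := by
    intro x y z
    simp only [Prod.fst_add, Prod.snd_add, sbr, LieSuper.br_add_left]
    rfl
  br_add_right := by
    intro x y z
    simp only [Prod.fst_add, Prod.snd_add, sbr, LieSuper.br_add_right]
    rfl
  br_smul_left := by
    intro c x y
    simp only [Prod.smul_fst, Prod.smul_snd, sbr, LieSuper.br_smul_left]
    rfl
  br_smul_right := by
    intro c x y
    simp only [Prod.smul_fst, Prod.smul_snd, sbr, LieSuper.br_smul_right]
    rfl
  br_gr := by
    intro a b x hx y hy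
    rw [Submodule.mem_prod] at hx hy ⊢
    exact ⟨LieSuper.br_gr a b x.1 hx.1 y.1 hy.1, LieSuper.br_gr a b x.2 hx.2 y.2 hy.2⟩
  br_skew := by
    intro a b x hx y hy
    rw [Submodule.mem_prod] at hx hy
    have h1 := LieSuper.br_skew (F := F) a b x.1 hx.1 y.1 hy.1
    have h2 := LieSuper.br_skew (F := F) a b x.2 hx.2 y.2 hy.2
    simp only [sbr]
    rw [Prod.ext_iff]
    exact ⟨h1, h2⟩
  br_jacobi := by
    intro a b c x hx y hy z hz
    rw [Submodule.mem_prod] at hx hy hz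
    have h1 := LieSuper.br_jacobi (F := F) a b c x.1 hx.1 y.1 hy.1 z.1 hz.1
    have h2 := LieSuper.br_jacobi (F := F) a b c x.2 hx.2 y.2 hy.2 z.2 hz.2
    simp only [sbr]
    rw [Prod.ext_iff]
    exact ⟨h1, h2⟩


section Helpers

theorem zmod2_cases : ∀ a : ZMod 2, a = 0 ∨ a = 1 := by decide

theorem sbr_add_left' {F : Type u} [Field F] {L : Type v} [AddCommGroup L] [Module F L]
    [LieSuper F L] (x y z : L) : sbr F (x + y) z = sbr F x z + sbr F y z :=
  LieSuper.br_add_left x y z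

theorem sbr_add_right' {F : Type u} [Field F] {L : Type v} [AddCommGroup L] [Module F L]
    [LieSuper F L] (x y z : L) : sbr F x (y + z) = sbr F x y + sbr F x z :=
  LieSuper.br_add_right x y z

/-- bracket as a bilinear map -/
def sbrL (F : Type u) [Field F] (L : Type v) [AddCommGroup L] [Module F L]
    [LieSuper F L] : L →ₗ[F] L →ₗ[F] L :=
  LinearMap.mk₂ F (fun x y => sbr F x y) LieSuper.br_add_left LieSuper.br_smul_left
    LieSuper.br_add_right LieSuper.br_smul_right

theorem sbrL_apply {F : Type u} [Field F] {L : Type v} [AddCommGroup L] [Module F L]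
    [LieSuper F L] (x y : L) : sbrL F L x y = sbr F x y := rfl

theorem sbr_zero_left {F : Type u} [Field F] {L : Type v} [AddCommGroup L] [Module F L]
    [LieSuper F L] (y : L) : sbr F (0 : L) y = 0 := by
  rw [← sbrL_apply]; simp

theorem sbr_zero_right {F : Type u} [Field F] {L : Type v} [AddCommGroup L] [Module F L]
    [LieSuper F L] (y : L) : sbr F y (0 : L) = 0 := by
  rw [← sbrL_apply]; simp

theorem homog_dec (F : Type u) [Field F] {L : Type v} [AddCommGroup L] [Module F L]
    [LieSuper F L] (x : L) : ∃ x0 ∈ grd F L 0, ∃ x1 ∈ grd F L 1, x0 + x1 = x := by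
  have h : IsCompl (grd F L 0) (grd F L 1) := LieSuper.isCompl_gr
  have hx : x ∈ grd F L 0 ⊔ grd F L 1 := by rw [h.codisjoint.eq_top]; trivial
  exact Submodule.mem_sup.mp hx

theorem homog_ind (F : Type u) [Field F] {L : Type v} [AddCommGroup L] [Module F L]
    [LieSuper F L] (P : L → Prop) (hh : ∀ a : ZMod 2, ∀ x ∈ grd F L a, P x)
    (ha : ∀ x y, P x → P y → P (x + y)) (x : L) : P x := by
  obtain ⟨x0, h0, x1, h1, rfl⟩ := homog_dec F x
  exact ha _ _ (hh 0 _ h0) (hh 1 _ h1)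

theorem homog_disj {F : Type u} [Field F] {L : Type v} [AddCommGroup L] [Module F L]
    [LieSuper F L] {x : L} (h0 : x ∈ grd F L 0) (h1 : x ∈ grd F L 1) : x = 0 := by
  have h : IsCompl (grd F L 0) (grd F L 1) := LieSuper.isCompl_gr
  simpa using h.disjoint.le_bot (Submodule.mem_inf.mpr ⟨h0, h1⟩)

theorem sg_comm' (F : Type u) [Field F] (a b : ZMod 2) : sg F a b = sg F b a := by
  simp [sg, mul_comm]

theorem sg_sq' (F : Type u) [Field F] (a b : ZMod 2) : sg F a b * sg F a b = 1 := by
  rw [sg, ← pow_add, Even.neg_one_pow ⟨_, rfl⟩]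

/-- Restrict a Lie superalgebra structure along an injective linear map. -/
@[reducible] noncomputable def ofInj {F : Type u} [Field F] {L : Type v} [AddCommGroup L] [Module F L]
    [LieSuper F L] {A : Type w} [AddCommGroup A] [Module F A] (j : A →ₗ[F] L)
    (hj : Injective j) (b : A → A → A) (hb : ∀ x y, j (b x y) = sbr F (j x) (j y))
    (hg : ∀ x : A, ∃ x0 x1 : A, j x0 ∈ grd F L 0 ∧ j x1 ∈ grd F L 1 ∧ x0 + x1 = x) :
    LieSuper F A where
  gr a := (grd F L a).comap j
  isCompl_gr := by
    constructor
    · rw [disjoint_iff, eq_bot_iff]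
      intro x hx
      obtain ⟨h0, h1⟩ := Submodule.mem_inf.mp hx
      have : j x = 0 := homog_disj h0 h1
      exact hj (by rw [this, map_zero])
    · rw [codisjoint_iff, eq_top_iff]
      rintro x -
      obtain ⟨x0, x1, h0, h1, h⟩ := hg x
      exact Submodule.mem_sup.mpr ⟨x0, h0, x1, h1, h⟩
  br := b
  br_add_left x y z := hj (by simp only [hb, map_add, sbr_add_left'])
  br_add_right x y z := hj (by simp only [hb, map_add, sbr_add_right'])
  br_smul_left c x y := hj (by
    simp only [hb, map_smul]; exact LieSuper.br_smul_left _ _ _)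
  br_smul_right c x y := hj (by
    simp only [hb, map_smul]; exact LieSuper.br_smul_right _ _ _)
  br_gr a c x hx y hy := by
    change j (b x y) ∈ grd F L (a + c)
    rw [hb]; exact LieSuper.br_gr a c _ hx _ hy
  br_skew a c x hx y hy := hj (by
    simp only [hb, map_smul]; exact LieSuper.br_skew a c _ hx _ hy)
  br_jacobi a c d x hx y hy z hz := hj (by
    simp only [hb, map_smul, map_add, map_zero]
    exact LieSuper.br_jacobi a c d _ hx _ hy _ hz)

noncomputable instance uliftLS (F : Type u) [Field F] (L : Type v) [AddCommGroup L]
    [Module F L] [LieSuper F L] : LieSuper F (ULift.{w} L) :=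
  ofInj (ULift.moduleEquiv (R := F) (M := L)).toLinearMap
    (ULift.moduleEquiv (R := F) (M := L)).injective
    (fun x y => ULift.up (sbr F x.down y.down)) (fun _ _ => rfl) (by
      intro x
      obtain ⟨x0, h0, x1, h1, h⟩ := homog_dec F x.down
      exact ⟨ULift.up x0, ULift.up x1, h0, h1, by
        apply ULift.down_injective; exact h⟩)

theorem up_hom (F : Type u) [Field F] (L : Type v) [AddCommGroup L]
    [Module F L] [LieSuper F L] :
    IsHom F (ULift.moduleEquiv.{u, v, w} (R := F) (M := L)).symm.toLinearMap :=
  ⟨fun _ _ hx => hx, fun _ _ => rfl⟩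

theorem down_hom (F : Type u) [Field F] (L : Type v) [AddCommGroup L]
    [Module F L] [LieSuper F L] :
    IsHom F (ULift.moduleEquiv.{u, v, w} (R := F) (M := L)).toLinearMap :=
  ⟨fun _ _ hx => hx, fun _ _ => rfl⟩

theorem IsHom.cmp {F : Type u} [Field F] {A B C : Type*}
    [AddCommGroup A] [Module F A] [LieSuper F A]
    [AddCommGroup B] [Module F B] [LieSuper F B]
    [AddCommGroup C] [Module F C] [LieSuper F C] {g : B →ₗ[F] C} {f : A →ₗ[F] B}
    (hg : IsHom F g) (hf : IsHom F f) : IsHom F (g ∘ₗ f) :=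
  ⟨fun a x hx => hg.1 a _ (hf.1 a x hx), fun x y => by
    simp only [LinearMap.comp_apply, hf.2, hg.2]⟩

theorem TensorRel.push {F : Type u} [Field F] {M N : Type v} {A B : Type*}
    [AddCommGroup M] [Module F M] [LieSuper F M]
    [AddCommGroup N] [Module F N] [LieSuper F N]
    [AddCommGroup A] [Module F A] [LieSuper F A]
    [AddCommGroup B] [Module F B] [LieSuper F B]
    {x : M → N → N} {y : N → M → M} {q : M → N → A} (h : TensorRel F x y q)
    {f : A →ₗ[F] B} (hf : IsHom F f) : TensorRel F x y (fun m n => f (q m n)) where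
  add_left m m' n := by rw [h.add_left, map_add]
  add_right m m' n := by rw [h.add_right, map_add]
  smul_left m m' n := by rw [h.smul_left, map_smul]
  smul_right m m' n := by rw [h.smul_right, map_smul]
  grade a b m hm n hn := hf.1 _ _ (h.grade a b m hm n hn)
  brk_left a b m hm m' hm' n := by rw [h.brk_left a b m hm m' hm', map_sub, map_smul]
  brk_right a b c m hm n hn n' hn' := by
    rw [h.brk_right a b c m hm n hn n' hn', map_sub, map_smul, map_smul]
  brk_brk a b m hm n hn m' n' := by
    rw [← hf.2, h.brk_brk a b m hm n hn, map_smul]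

theorem ExtRel.push {F : Type u} [Field F] {M : Type v} {A B : Type*}
    [AddCommGroup M] [Module F M] [LieSuper F M]
    [AddCommGroup A] [Module F A] [LieSuper F A]
    [AddCommGroup B] [Module F B] [LieSuper F B]
    {q : M → M → A} (h : ExtRel F q)
    {f : A →ₗ[F] B} (hf : IsHom F f) : ExtRel F (fun m n => f (q m n)) where
  toTensor := h.toTensor.push hf
  alt a b x hx y hy := by rw [h.alt a b x hx y hy, map_smul]
  alt_even x hx := by rw [h.alt_even x hx, map_zero]

theorem ExtRel.pull {F : Type u} [Field F] {L M : Type v} {A : Type w}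
    [AddCommGroup L] [Module F L] [LieSuper F L]
    [AddCommGroup M] [Module F M] [LieSuper F M]
    [AddCommGroup A] [Module F A] [LieSuper F A]
    {q : M → M → A} (h : ExtRel F q)
    {f : L →ₗ[F] M} (hf : IsHom F f) : ExtRel F (fun m n => q (f m) (f n)) where
  toTensor :=
    { add_left := fun m m' n => by rw [map_add, h.toTensor.add_left]
      add_right := fun m m' n => by rw [map_add, h.toTensor.add_right]
      smul_left := fun m m' n => by rw [map_smul, h.toTensor.smul_left]
      smul_right := fun m m' n => by rw [map_smul, h.toTensor.smul_right]
      grade := fun a b m hm n hn => h.toTensor.grade a b _ (hf.1 _ _ hm) _ (hf.1 _ _ hn)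
      brk_left := fun a b m hm m' hm' n => by
        simp only [hf.2]
        exact h.toTensor.brk_left a b _ (hf.1 _ _ hm) _ (hf.1 _ _ hm') _
      brk_right := fun a b c m hm n hn n' hn' => by
        simp only [hf.2]
        exact h.toTensor.brk_right a b c _ (hf.1 _ _ hm) _ (hf.1 _ _ hn) _ (hf.1 _ _ hn')
      brk_brk := fun a b m hm n hn m' n' => by
        simp only [hf.2]
        exact h.toTensor.brk_brk a b _ (hf.1 _ _ hm) _ (hf.1 _ _ hn) _ _ }
  alt a b x hx y hy := h.alt a b _ (hf.1 _ _ hx) _ (hf.1 _ _ hy)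
  alt_even x hx := h.alt_even _ (hf.1 _ _ hx)

theorem up_aux {F : Type u} [Field F] {T Q : Type v}
    [AddCommGroup T] [Module F T] [LieSuper F T]
    [AddCommGroup Q] [Module F Q] [LieSuper F Q] {P : (T →ₗ[F] Q) → Prop}
    (hP : ∃! h : T →ₗ[F] ULift.{u} Q, IsHom F h ∧ P (ULift.moduleEquiv.toLinearMap ∘ₗ h)) :
    ∃! h : T →ₗ[F] Q, IsHom F h ∧ P h := by
  obtain ⟨h, ⟨h1, h2⟩, h3⟩ := hP
  refine ⟨ULift.moduleEquiv.toLinearMap ∘ₗ h, ⟨(down_hom F Q).cmp h1, h2⟩, ?_⟩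
  rintro g ⟨g1, g2⟩
  rw [← h3 (ULift.moduleEquiv.symm.toLinearMap ∘ₗ g) ⟨(up_hom F Q).cmp g1, g2⟩]
  rfl

theorem IsExtObj.lift' {F : Type u} [Field F] {L E Q : Type v}
    [AddCommGroup L] [Module F L] [LieSuper F L]
    [AddCommGroup E] [Module F E] [LieSuper F E]
    [AddCommGroup Q] [Module F Q] [LieSuper F Q]
    {t : L → L → E} (hE : IsExtObj F t) {q : L → L → Q} (hq : ExtRel F q) :
    ∃! h : E →ₗ[F] Q, IsHom F h ∧ ∀ x y : L, h (t x y) = q x y := by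
  apply up_aux
  obtain ⟨h, ⟨h1, h2⟩, h3⟩ := hE.lift ⟨ULift.{u} Q⟩ _ (hq.push (up_hom F Q))
  refine ⟨h, ⟨h1, fun x y => ?_⟩, ?_⟩
  · have := congrArg ULift.down (h2 x y)
    exact this
  · rintro g ⟨g1, g2⟩
    exact h3 g ⟨g1, fun x y => ULift.down_injective (g2 x y)⟩

theorem IsTensorObj.lift' {F : Type u} [Field F] {M N T Q : Type v}
    [AddCommGroup M] [Module F M] [LieSuper F M]
    [AddCommGroup N] [Module F N] [LieSuper F N]
    [AddCommGroup T] [Module F T] [LieSuper F T]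
    [AddCommGroup Q] [Module F Q] [LieSuper F Q] {u : M → N → N} {v : N → M → M}
    {t : M → N → T} (hE : IsTensorObj F u v t) {q : M → N → Q} (hq : TensorRel F u v q) :
    ∃! h : T →ₗ[F] Q, IsHom F h ∧ ∀ x y, h (t x y) = q x y := by
  apply up_aux
  obtain ⟨h, ⟨h1, h2⟩, h3⟩ := hE.lift ⟨ULift.{u} Q⟩ _ (hq.push (up_hom F Q))
  refine ⟨h, ⟨h1, fun x y => ?_⟩, ?_⟩
  · have := congrArg ULift.down (h2 x y)
    exact this
  · rintro g ⟨g1, g2⟩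
    exact h3 g ⟨g1, fun x y => ULift.down_injective (g2 x y)⟩

/-- the pairing as a bilinear map -/
def TensorRel.bil {F : Type u} [Field F] {M N : Type v} {A : Type w}
    [AddCommGroup M] [Module F M] [LieSuper F M]
    [AddCommGroup N] [Module F N] [LieSuper F N]
    [AddCommGroup A] [Module F A] [LieSuper F A]
    {x : M → N → N} {y : N → M → M} {q : M → N → A} (h : TensorRel F x y q) :
    M →ₗ[F] N →ₗ[F] A :=
  LinearMap.mk₂ F q h.add_left h.smul_left h.add_right h.smul_right

theorem TensorRel.bil_apply {F : Type u} [Field F] {M N : Type v} {A : Type w}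
    [AddCommGroup M] [Module F M] [LieSuper F M]
    [AddCommGroup N] [Module F N] [LieSuper F N]
    [AddCommGroup A] [Module F A] [LieSuper F A]
    {x : M → N → N} {y : N → M → M} {q : M → N → A} (h : TensorRel F x y q) (m : M) (n : N) :
    h.bil m n = q m n := rfl

theorem TensorRel.zero_l {F : Type u} [Field F] {M N : Type v} {A : Type w}
    [AddCommGroup M] [Module F M] [LieSuper F M]
    [AddCommGroup N] [Module F N] [LieSuper F N]
    [AddCommGroup A] [Module F A] [LieSuper F A]
    {x : M → N → N} {y : N → M → M} {q : M → N → A} (h : TensorRel F x y q) (n : N) :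
    q 0 n = 0 := by rw [← h.bil_apply]; simp

theorem TensorRel.zero_r {F : Type u} [Field F] {M N : Type v} {A : Type w}
    [AddCommGroup M] [Module F M] [LieSuper F M]
    [AddCommGroup N] [Module F N] [LieSuper F N]
    [AddCommGroup A] [Module F A] [LieSuper F A]
    {x : M → N → N} {y : N → M → M} {q : M → N → A} (h : TensorRel F x y q) (m : M) :
    q m 0 = 0 := by rw [← h.bil_apply]; simp

/-- The exterior square is linearly spanned by the pure wedges. -/
theorem IsExtObj.span_top {F : Type u} [Field F] {L E : Type v}
    [AddCommGroup L] [Module F L] [LieSuper F L]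
    [AddCommGroup E] [Module F E] [LieSuper F E]
    {t : L → L → E} (hE : IsExtObj F t) :
    Submodule.span F {z : E | ∃ x y, z = t x y} = ⊤ := by
  set S := Submodule.span F {z : E | ∃ x y, z = t x y} with hS
  have ht : ∀ x y, t x y ∈ S := fun x y => Submodule.subset_span ⟨x, y, rfl⟩
  have T := hE.rel.toTensor
  have hbr : ∀ x ∈ S, ∀ y ∈ S, sbr F x y ∈ S := by
    intro x hx y hy
    rw [← sbrL_apply]
    induction hx using Submodule.span_induction with
    | zero => simp
    | add a b _ _ ha hb => simpa using S.add_mem ha hb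
    | smul c a _ ha => simpa using S.smul_mem c ha
    | mem z hz =>
      obtain ⟨m, n, rfl⟩ := hz
      induction hy using Submodule.span_induction with
      | zero => simp
      | add a b _ _ ha hb => simpa using S.add_mem ha hb
      | smul c a _ ha => simpa using S.smul_mem c ha
      | mem z hz =>
        obtain ⟨m', n', rfl⟩ := hz
        refine homog_ind F (fun m => sbrL F E (t m n) (t m' n') ∈ S) ?_ ?_ m
        · intro a m hm
          refine homog_ind F (fun n => sbrL F E (t m n) (t m' n') ∈ S) ?_ ?_ n
          · intro b n hn
            show sbr F _ _ ∈ S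
            rw [T.brk_brk a b m hm n hn]
            exact S.smul_mem _ (ht _ _)
          · intro x y hx hy
            simp only [T.add_right, map_add, LinearMap.add_apply]
            exact S.add_mem hx hy
        · intro x y hx hy
          simp only [T.add_left, map_add, LinearMap.add_apply]
          exact S.add_mem hx hy
  have hgr : ∀ x ∈ S, ∃ x0 x1, x0 ∈ S ∧ x1 ∈ S ∧ x0 ∈ grd F E 0 ∧ x1 ∈ grd F E 1 ∧
      x0 + x1 = x := by
    intro x hx
    have hadd : ∀ x y : E, (∃ x0 x1, x0 ∈ S ∧ x1 ∈ S ∧ x0 ∈ grd F E 0 ∧ x1 ∈ grd F E 1 ∧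
      x0 + x1 = x) → (∃ x0 x1, x0 ∈ S ∧ x1 ∈ S ∧ x0 ∈ grd F E 0 ∧ x1 ∈ grd F E 1 ∧
      x0 + x1 = y) → (∃ x0 x1, x0 ∈ S ∧ x1 ∈ S ∧ x0 ∈ grd F E 0 ∧ x1 ∈ grd F E 1 ∧
      x0 + x1 = x + y) := by
      rintro _ _ ⟨a, b, ha, hb, ha', hb', rfl⟩ ⟨c, d, hc, hd, hc', hd', rfl⟩
      exact ⟨a + c, b + d, S.add_mem ha hc, S.add_mem hb hd, Submodule.add_mem _ ha' hc',
        Submodule.add_mem _ hb' hd', by abel⟩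
    induction hx using Submodule.span_induction with
    | zero => exact ⟨0, 0, S.zero_mem, S.zero_mem, zero_mem _, zero_mem _, add_zero _⟩
    | add a b _ _ ha hb => exact hadd _ _ ha hb
    | smul c a _ ha =>
      obtain ⟨a, b, ha, hb, ha', hb', rfl⟩ := ha
      exact ⟨c • a, c • b, S.smul_mem _ ha, S.smul_mem _ hb, Submodule.smul_mem _ _ ha',
        Submodule.smul_mem _ _ hb', by simp⟩
    | mem z hz =>
      obtain ⟨m, n, rfl⟩ := hz
      refine homog_ind F (fun m => ∃ x0 x1, x0 ∈ S ∧ x1 ∈ S ∧ x0 ∈ grd F E 0 ∧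
        x1 ∈ grd F E 1 ∧ x0 + x1 = t m n) ?_ ?_ m
      · intro a m hm
        refine homog_ind F (fun n => ∃ x0 x1, x0 ∈ S ∧ x1 ∈ S ∧ x0 ∈ grd F E 0 ∧
          x1 ∈ grd F E 1 ∧ x0 + x1 = t m n) ?_ ?_ n
        · intro b n hn
          have h := T.grade a b m hm n hn
          generalize a + b = c at h
          obtain rfl | rfl := zmod2_cases c
          · exact ⟨t m n, 0, ht _ _, zero_mem _, h, zero_mem _, add_zero _⟩
          · exact ⟨0, t m n, zero_mem _, ht _ _, zero_mem _, h, zero_add _⟩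
        · intro x y hx hy
          simp only [T.add_right]
          exact hadd _ _ hx hy
      · intro x y hx hy
        simp only [T.add_left]
        exact hadd _ _ hx hy
  let _ : LieSuper F S := ofInj S.subtype S.injective_subtype
    (fun x y => ⟨sbr F x.1 y.1, hbr _ x.2 _ y.2⟩) (fun _ _ => rfl) (by
      rintro ⟨x, hx⟩
      obtain ⟨a, b, ha, hb, ha', hb', rfl⟩ := hgr x hx
      exact ⟨⟨a, ha⟩, ⟨b, hb⟩, ha', hb', rfl⟩)
  have hsub : IsHom F S.subtype := ⟨fun _ _ h => h, fun _ _ => rfl⟩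
  have hq : ExtRel F (fun x y => (⟨t x y, ht x y⟩ : S)) := by
    refine ⟨⟨?_, ?_, ?_, ?_, ?_, ?_, ?_, ?_⟩, ?_, ?_⟩
    · exact fun _ _ _ => Subtype.ext (T.add_left _ _ _)
    · exact fun _ _ _ => Subtype.ext (T.add_right _ _ _)
    · exact fun _ _ _ => Subtype.ext (T.smul_left _ _ _)
    · exact fun _ _ _ => Subtype.ext (T.smul_right _ _ _)
    · exact fun a b m hm n hn => T.grade a b m hm n hn
    · exact fun a b m hm n hn x => Subtype.ext (T.brk_left a b m hm n hn x)
    · exact fun a b c m hm n hn x hx => Subtype.ext (T.brk_right a b c m hm n hn x hx)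
    · exact fun a b m hm n hn x y => Subtype.ext (T.brk_brk a b m hm n hn x y)
    · exact fun a b m hm n hn => Subtype.ext (hE.rel.alt a b m hm n hn)
    · exact fun m hm => Subtype.ext (hE.rel.alt_even m hm)
  obtain ⟨h, ⟨h1, h2⟩, -⟩ := hE.lift' hq
  have hid : IsHom F (LinearMap.id : E →ₗ[F] E) := ⟨fun _ _ h => h, fun _ _ => rfl⟩
  have := (hE.lift' hE.rel).unique (y₁ := S.subtype ∘ₗ h) (y₂ := LinearMap.id)
    ⟨hsub.cmp h1, fun x y => by simp [h2]⟩ ⟨hid, fun _ _ => rfl⟩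
  rw [eq_top_iff]
  rintro x -
  have hx := LinearMap.congr_fun this x
  simp only [LinearMap.comp_apply, LinearMap.id_apply] at hx
  rw [← hx]
  exact (h x).2

theorem homog_lift {F : Type u} [Field F] {A B : Type*}
    [AddCommGroup A] [Module F A] [LieSuper F A]
    [AddCommGroup B] [Module F B] [LieSuper F B] {p : A →ₗ[F] B} (hp : IsHom F p)
    (hs : Surjective p) (a : ZMod 2) (y : B) (hy : y ∈ grd F B a) :
    ∃ x ∈ grd F A a, p x = y := by
  obtain ⟨x, rfl⟩ := hs y
  obtain ⟨x0, h0, x1, h1, rfl⟩ := homog_dec F x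
  have k0 := hp.1 _ _ h0
  have k1 := hp.1 _ _ h1
  rw [map_add] at hy
  obtain rfl | rfl := zmod2_cases a
  · refine ⟨x0, h0, ?_⟩
    have : p x1 ∈ grd F B 0 := by
      have := Submodule.sub_mem _ hy k0
      simpa using this
    rw [map_add, homog_disj this k1, add_zero]
  · refine ⟨x1, h1, ?_⟩
    have : p x0 ∈ grd F B 1 := by
      have := Submodule.sub_mem _ hy k1
      simpa using this
    rw [map_add, homog_disj k0 this, zero_add]

theorem exists_odd (F : Type u) [Field F] (L : Type v) [AddCommGroup L] [Module F L]
    [LieSuper F L] : ∃ P : L →ₗ[F] L, (∀ x ∈ grd F L 0, P x = 0) ∧ ∀ x ∈ grd F L 1, P x = x := by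
  have h : IsCompl (grd F L 0) (grd F L 1) := LieSuper.isCompl_gr
  refine ⟨(grd F L 1).subtype ∘ₗ Submodule.projectionOnto _ _ h.symm, ?_, ?_⟩
  · intro x hx
    simp only [LinearMap.comp_apply]
    rw [(Submodule.projectionOnto_apply_eq_zero_iff h.symm).mpr hx]
    simp
  · intro x hx
    simp only [LinearMap.comp_apply]
    have := Submodule.projectionOnto_apply_left h.symm ⟨x, hx⟩
    simp only at this
    rw [this]
    rfl

/-- The sign-twisted version of a bilinear map. -/
theorem exists_twist {F : Type u} [Field F] {M N : Type v} {A : Type w}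
    [AddCommGroup M] [Module F M] [LieSuper F M]
    [AddCommGroup N] [Module F N] [LieSuper F N]
    [AddCommGroup A] [Module F A] (B : M →ₗ[F] N →ₗ[F] A) :
    ∃ C : M →ₗ[F] N →ₗ[F] A, ∀ a b : ZMod 2, ∀ m ∈ grd F M a, ∀ n ∈ grd F N b,
      C m n = sg F a b • B m n := by
  obtain ⟨P, P0, P1⟩ := exists_odd F M
  obtain ⟨R, R0, R1⟩ := exists_odd F N
  refine ⟨B - (2 : F) • B.compl₁₂ P R, ?_⟩
  intro a b m hm n hn
  simp only [LinearMap.sub_apply, LinearMap.smul_apply, LinearMap.compl₁₂_apply]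
  obtain rfl | rfl := zmod2_cases a <;> obtain rfl | rfl := zmod2_cases b
  · rw [P0 m hm]; simp [sg]
  · rw [P0 m hm]; simp [sg]
  · rw [R0 n hn]; simp [sg]
  · rw [P1 m hm, R1 n hn]
    have : sg F 1 1 = -1 := by simp [sg, ZMod.val_one]
    rw [this]
    module

theorem mem_grd_prod {F : Type u} [Field F] {A B : Type*}
    [AddCommGroup A] [Module F A] [LieSuper F A]
    [AddCommGroup B] [Module F B] [LieSuper F B] {a : ZMod 2} {x : A} {y : B}
    (hx : x ∈ grd F A a) (hy : y ∈ grd F B a) : (x, y) ∈ grd F (A × B) a := ⟨hx, hy⟩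

theorem sbr_prod {F : Type u} [Field F] {A B : Type*}
    [AddCommGroup A] [Module F A] [LieSuper F A]
    [AddCommGroup B] [Module F B] [LieSuper F B] (x y : A × B) :
    sbr F x y = (sbr F x.1 y.1, sbr F x.2 y.2) := rfl

theorem inl_hom (F : Type u) [Field F] (A B : Type*)
    [AddCommGroup A] [Module F A] [LieSuper F A]
    [AddCommGroup B] [Module F B] [LieSuper F B] : IsHom F (LinearMap.inl F A B) :=
  ⟨fun _ _ h => mem_grd_prod h (zero_mem _), fun x y => by
    simp [sbr_prod, sbr_zero_left]⟩

theorem inr_hom (F : Type u) [Field F] (A B : Type*)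
    [AddCommGroup A] [Module F A] [LieSuper F A]
    [AddCommGroup B] [Module F B] [LieSuper F B] : IsHom F (LinearMap.inr F A B) :=
  ⟨fun _ _ h => mem_grd_prod (zero_mem _) h, fun x y => by
    simp [sbr_prod, sbr_zero_left]⟩

theorem fst_hom (F : Type u) [Field F] (A B : Type*)
    [AddCommGroup A] [Module F A] [LieSuper F A]
    [AddCommGroup B] [Module F B] [LieSuper F B] : IsHom F (LinearMap.fst F A B) :=
  ⟨fun _ _ h => h.1, fun _ _ => rfl⟩

theorem snd_hom (F : Type u) [Field F] (A B : Type*)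
    [AddCommGroup A] [Module F A] [LieSuper F A]
    [AddCommGroup B] [Module F B] [LieSuper F B] : IsHom F (LinearMap.snd F A B) :=
  ⟨fun _ _ h => h.2, fun _ _ => rfl⟩

theorem ExtRel.prod {F : Type u} [Field F] {L : Type v} {A B : Type*}
    [AddCommGroup L] [Module F L] [LieSuper F L]
    [AddCommGroup A] [Module F A] [LieSuper F A]
    [AddCommGroup B] [Module F B] [LieSuper F B] {q : L → L → A} {r : L → L → B}
    (hq : ExtRel F q) (hr : ExtRel F r) : ExtRel F (fun x y => (q x y, r x y)) := by
  have T := hq.toTensor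
  have U := hr.toTensor
  refine ⟨⟨?_, ?_, ?_, ?_, ?_, ?_, ?_, ?_⟩, ?_, ?_⟩
  · exact fun _ _ _ => Prod.ext (T.add_left _ _ _) (U.add_left _ _ _)
  · exact fun _ _ _ => Prod.ext (T.add_right _ _ _) (U.add_right _ _ _)
  · exact fun _ _ _ => Prod.ext (T.smul_left _ _ _) (U.smul_left _ _ _)
  · exact fun _ _ _ => Prod.ext (T.smul_right _ _ _) (U.smul_right _ _ _)
  · exact fun a b m hm n hn => mem_grd_prod (T.grade a b m hm n hn) (U.grade a b m hm n hn)
  · exact fun a b m hm n hn x =>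
      Prod.ext (T.brk_left a b m hm n hn x) (U.brk_left a b m hm n hn x)
  · exact fun a b c m hm n hn x hx =>
      Prod.ext (T.brk_right a b c m hm n hn x hx) (U.brk_right a b c m hm n hn x hx)
  · exact fun a b m hm n hn x y =>
      Prod.ext (T.brk_brk a b m hm n hn x y) (U.brk_brk a b m hm n hn x y)
  · exact fun a b m hm n hn => Prod.ext (hq.alt a b m hm n hn) (hr.alt a b m hm n hn)
  · exact fun m hm => Prod.ext (hq.alt_even m hm) (hr.alt_even m hm)

/-- an "abelian" exterior pairing -/
theorem ExtRel.ofAb {F : Type u} [Field F] {L : Type v} {A : Type w}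
    [AddCommGroup L] [Module F L] [LieSuper F L]
    [AddCommGroup A] [Module F A] [LieSuper F A] (c : L →ₗ[F] L →ₗ[F] A)
    (hg : ∀ a b : ZMod 2, ∀ m ∈ grd F L a, ∀ n ∈ grd F L b, c m n ∈ grd F A (a + b))
    (hl : ∀ x y z, c (sbr F x y) z = 0) (hr : ∀ x y z, c x (sbr F y z) = 0)
    (hbb : ∀ x y z w, sbr F (c x y) (c z w) = 0)
    (halt : ∀ a b : ZMod 2, ∀ x ∈ grd F L a, ∀ y ∈ grd F L b, c x y = -(sg F a b) • c y x)
    (he : ∀ x ∈ grd F L 0, c x x = 0) : ExtRel F (fun x y => c x y) := by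
  refine ⟨⟨?_, ?_, ?_, ?_, ?_, ?_, ?_, ?_⟩, ?_, ?_⟩
  · simp
  · simp
  · simp
  · simp
  · exact hg
  · intros; simp [hl, hr]
  · intros; simp [hl, hr]
  · intros; simp [hl, hbb]
  · exact halt
  · exact he

end Helpers

/-- for Lie superalgebras `H` and `K`,
`(H ⊕ K) ∧ (H ⊕ K) ≅ (H ∧ H) ⊕ (K ∧ K) ⊕ (H/H' ⊗ K/K')`, where the last factor
is the non-abelian tensor product of the abelianizations with trivial mutual
actions. -/
theorem exterior_square_prod (F : Type u) [Field F]
    (hchar2 : (2 : F) ≠ 0) (hchar3 : (3 : F) ≠ 0)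
    (H : Type v) [AddCommGroup H] [Module F H] [LieSuper F H]
    (K : Type v) [AddCommGroup K] [Module F K] [LieSuper F K]
    -- the exterior square of `H ⊕ K`:
    (E : Type v) [AddCommGroup E] [Module F E] [LieSuper F E]
    (t : H × K → H × K → E) (hE : IsExtObj F t)
    -- the exterior squares of `H` and `K`:
    (EH : Type v) [AddCommGroup EH] [Module F EH] [LieSuper F EH]
    (tH : H → H → EH) (hEH : IsExtObj F tH)
    (EK : Type v) [AddCommGroup EK] [Module F EK] [LieSuper F EK]
    (tK : K → K → EK) (hEK : IsExtObj F tK)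
    -- the abelianizations `H/H'` and `K/K'`:
    (QH : Type v) [AddCommGroup QH] [Module F QH] [LieSuper F QH]
    (pH : H →ₗ[F] QH) (hpH : IsHom F pH) (hpHs : Surjective pH)
    (hkerH : LinearMap.ker pH = derived F H)
    (QK : Type v) [AddCommGroup QK] [Module F QK] [LieSuper F QK]
    (pK : K →ₗ[F] QK) (hpK : IsHom F pK) (hpKs : Surjective pK)
    (hkerK : LinearMap.ker pK = derived F K)
    -- the tensor product `H/H' ⊗ K/K'` with trivial mutual actions:
    (TQ : Type v) [AddCommGroup TQ] [Module F TQ] [LieSuper F TQ]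
    (tQ : QH → QK → TQ)
    (hTQ : IsTensorObj F (fun (_ : QH) (_ : QK) => (0 : QK))
      (fun (_ : QK) (_ : QH) => (0 : QH)) tQ) :
    ∃ e : E ≃ₗ[F] EH × EK × TQ, IsHom F e.toLinearMap := by
  classical
  have T := hE.rel.toTensor
  have TT := hTQ.rel
  have TH := hEH.rel.toTensor
  have TK := hEK.rel.toTensor
  have pH0 : ∀ x y : H, pH (sbr F x y) = 0 := fun x y => by
    rw [← LinearMap.mem_ker, hkerH]
    exact Submodule.subset_span ⟨x, trivial, y, trivial, rfl⟩
  have pK0 : ∀ x y : K, pK (sbr F x y) = 0 := fun x y => by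
    rw [← LinearMap.mem_ker, hkerK]
    exact Submodule.subset_span ⟨x, trivial, y, trivial, rfl⟩
  -- the mixed pairing
  let B0 : H →ₗ[F] K →ₗ[F] TQ := TT.bil.compl₁₂ pH pK
  have B0a : ∀ h k, B0 h k = tQ (pH h) (pK k) := fun _ _ => rfl
  obtain ⟨C, hC⟩ := exists_twist B0
  have hB0l : ∀ x y k, B0 (sbr F x y) k = 0 := fun x y k => by
    rw [B0a, pH0, TT.zero_l]
  have hB0r : ∀ h x y, B0 h (sbr F x y) = 0 := fun h x y => by
    rw [B0a, pK0, TT.zero_r]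
  have hCl : ∀ x y k, C (sbr F x y) k = 0 := by
    intro x y k
    refine homog_ind F (fun x => C (sbr F x y) k = 0) ?_ ?_ x
    · intro a x hx
      refine homog_ind F (fun y => C (sbr F x y) k = 0) ?_ ?_ y
      · intro b y hy
        refine homog_ind F (fun k => C (sbr F x y) k = 0) ?_ ?_ k
        · intro c k hk
          rw [hC (a + b) c (sbr F x y) (LieSuper.br_gr a b x hx y hy) k hk, hB0l, smul_zero]
        · intro u v hu hv
          rw [map_add, hu, hv, add_zero]
      · intro u v hu hv
        rw [sbr_add_right', map_add, LinearMap.add_apply, hu, hv, add_zero]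
    · intro u v hu hv
      rw [sbr_add_left', map_add, LinearMap.add_apply, hu, hv, add_zero]
  have hCr : ∀ h x y, C h (sbr F x y) = 0 := by
    intro k x y
    refine homog_ind F (fun x => C k (sbr F x y) = 0) ?_ ?_ x
    · intro a x hx
      refine homog_ind F (fun y => C k (sbr F x y) = 0) ?_ ?_ y
      · intro b y hy
        refine homog_ind F (fun k => C k (sbr F x y) = 0) ?_ ?_ k
        · intro c k hk
          rw [hC c (a + b) k hk (sbr F x y) (LieSuper.br_gr a b x hx y hy), hB0r, smul_zero]
        · intro u v hu hv
          rw [map_add, LinearMap.add_apply, hu, hv, add_zero]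
      · intro u v hu hv
        rw [sbr_add_right', map_add, hu, hv, add_zero]
    · intro u v hu hv
      rw [sbr_add_left', map_add, hu, hv, add_zero]
  -- brackets in TQ of pure tensors vanish
  have hTQbr : ∀ x y z w, sbr F (tQ x y) (tQ z w) = 0 := by
    intro x y z w
    refine homog_ind F (fun x => sbr F (tQ x y) (tQ z w) = 0) ?_ ?_ x
    · intro a x hx
      refine homog_ind F (fun y => sbr F (tQ x y) (tQ z w) = 0) ?_ ?_ y
      · intro b y hy
        rw [TT.brk_brk a b x hx y hy, TT.zero_l, smul_zero]
      · intro u v hu hv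
        rw [TT.add_right, sbr_add_left', hu, hv, add_zero]
    · intro u v hu hv
      rw [TT.add_left, sbr_add_left', hu, hv, add_zero]
  let S : Submodule F TQ := Submodule.span F {z | ∃ x y, z = tQ x y}
  have hS : ∀ x ∈ S, ∀ y ∈ S, sbr F x y = 0 := by
    intro x hx y hy
    rw [← sbrL_apply]
    induction hx using Submodule.span_induction with
    | zero => simp
    | add a b _ _ ha hb => rw [map_add, LinearMap.add_apply, ha, hb, add_zero]
    | smul c a _ ha => rw [map_smul, LinearMap.smul_apply, ha, smul_zero]
    | mem z hz =>
      obtain ⟨m, n, rfl⟩ := hz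
      induction hy using Submodule.span_induction with
      | zero => simp
      | add a b _ _ ha hb => rw [map_add, ha, hb, add_zero]
      | smul c a _ ha => rw [map_smul, ha, smul_zero]
      | mem z hz =>
        obtain ⟨m', n', rfl⟩ := hz
        exact hTQbr _ _ _ _
  have hB0S : ∀ h k, B0 h k ∈ S := fun h k => Submodule.subset_span ⟨_, _, rfl⟩
  have hCS : ∀ h k, C h k ∈ S := by
    intro h k
    refine homog_ind F (fun h => C h k ∈ S) ?_ ?_ h
    · intro a h hh
      refine homog_ind F (fun k => C h k ∈ S) ?_ ?_ k
      · intro b k hk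
        rw [hC a b h hh k hk]
        exact S.smul_mem _ (hB0S _ _)
      · intro u v hu hv
        rw [map_add]; exact S.add_mem hu hv
    · intro u v hu hv
      rw [map_add, LinearMap.add_apply]; exact S.add_mem hu hv
  have hB0g : ∀ a b : ZMod 2, ∀ h ∈ grd F H a, ∀ k ∈ grd F K b, B0 h k ∈ grd F TQ (a + b) :=
    fun a b h hh k hk => TT.grade a b _ (hpH.1 _ _ hh) _ (hpK.1 _ _ hk)
  let c : (H × K) →ₗ[F] (H × K) →ₗ[F] TQ :=
    B0.compl₁₂ (LinearMap.fst F H K) (LinearMap.snd F H K) -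
      C.flip.compl₁₂ (LinearMap.snd F H K) (LinearMap.fst F H K)
  have ca : ∀ x y, c x y = B0 x.1 y.2 - C y.1 x.2 := fun _ _ => rfl
  have hc : ExtRel F (fun x y => c x y) := by
    apply ExtRel.ofAb
    · intro a b x hx y hy
      rw [ca, hC b a _ hy.1 _ hx.2]
      refine Submodule.sub_mem _ (hB0g a b _ hx.1 _ hy.2) (Submodule.smul_mem _ _ ?_)
      rw [add_comm]
      exact hB0g b a _ hy.1 _ hx.2
    · intro x y z
      rw [ca, sbr_prod, hB0l, hCr, sub_zero]
    · intro x y z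
      rw [ca, sbr_prod, hB0r, hCl, sub_zero]
    · intro x y z w
      exact hS _ (S.sub_mem (hB0S _ _) (hCS _ _)) _ (S.sub_mem (hB0S _ _) (hCS _ _))
    · intro a b x hx y hy
      rw [ca, ca, hC b a _ hy.1 _ hx.2, hC a b _ hx.1 _ hy.2, smul_sub, smul_smul, neg_mul,
        sg_sq', sg_comm' F b a]
      module
    · intro x hx
      rw [ca, hC 0 0 _ hx.1 _ hx.2]
      simp [sg]
  have hq := (hEH.rel.pull (fst_hom F H K)).prod ((hEK.rel.pull (snd_hom F H K)).prod hc)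
  obtain ⟨φ, ⟨φ1, φ2⟩, -⟩ := hE.lift' hq
  -- the inverse
  obtain ⟨f, ⟨f1, f2⟩, -⟩ := hEH.lift' (hE.rel.pull (inl_hom F H K))
  obtain ⟨g, ⟨g1, g2⟩, -⟩ := hEK.lift' (hE.rel.pull (inr_hom F H K))
  let B : H →ₗ[F] K →ₗ[F] E := T.bil.compl₁₂ (LinearMap.inl F H K) (LinearMap.inr F H K)
  have Ba : ∀ h k, B h k = t (h, 0) (0, k) := fun _ _ => rfl
  have gl : ∀ (a : ZMod 2) (h : H), h ∈ grd F H a → ((h, 0) : H × K) ∈ grd F (H × K) a :=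
    fun a h hh => mem_grd_prod hh (zero_mem _)
  have gr' : ∀ (a : ZMod 2) (k : K), k ∈ grd F K a → ((0, k) : H × K) ∈ grd F (H × K) a :=
    fun a h hh => mem_grd_prod (zero_mem _) hh
  have z1 : ∀ (h : H) (k : K), sbr F ((h, 0) : H × K) (0, k) = 0 := fun h k => by
    rw [sbr_prod]; simp [sbr_zero_left, sbr_zero_right]
  have z2 : ∀ (h : H) (k : K), sbr F ((0, k) : H × K) (h, 0) = 0 := fun h k => by
    rw [sbr_prod]; simp [sbr_zero_left, sbr_zero_right]
  have hBl : ∀ x y k, B (sbr F x y) k = 0 := by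
    intro x y k
    refine homog_ind F (fun x => B (sbr F x y) k = 0) ?_ ?_ x
    · intro a x hx
      refine homog_ind F (fun y => B (sbr F x y) k = 0) ?_ ?_ y
      · intro b y hy
        have := T.brk_left a b (x, 0) (gl _ _ hx) (y, 0) (gl _ _ hy) (0, k)
        simp only [z1, T.zero_r, smul_zero, sub_zero] at this
        rw [Ba, ← this, sbr_prod]
        simp [sbr_zero_left]
      · intro u v hu hv
        rw [sbr_add_right', map_add, LinearMap.add_apply, hu, hv, add_zero]
    · intro u v hu hv
      rw [sbr_add_left', map_add, LinearMap.add_apply, hu, hv, add_zero]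
  have hBr : ∀ h x y, B h (sbr F x y) = 0 := by
    intro k x y
    refine homog_ind F (fun x => B k (sbr F x y) = 0) ?_ ?_ x
    · intro a x hx
      refine homog_ind F (fun y => B k (sbr F x y) = 0) ?_ ?_ y
      · intro b y hy
        refine homog_ind F (fun k => B k (sbr F x y) = 0) ?_ ?_ k
        · intro c k hk
          have := T.brk_right c a b (k, 0) (gl _ _ hk) (0, x) (gr' _ _ hx) (0, y) (gr' _ _ hy)
          simp only [z2, T.zero_l, smul_zero, sub_zero] at this
          rw [Ba, ← this, sbr_prod]
          simp [sbr_zero_left]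
        · intro u v hu hv
          rw [map_add, LinearMap.add_apply, hu, hv, add_zero]
      · intro u v hu hv
        rw [sbr_add_right', map_add, hu, hv, add_zero]
    · intro u v hu hv
      rw [sbr_add_left', map_add, hu, hv, add_zero]
  have kB1 : ∀ x k, pH x = 0 → B x k = 0 := by
    intro x k hx
    rw [← LinearMap.mem_ker, hkerH] at hx
    have : derived F H ≤ LinearMap.ker (B.flip k) := by
      refine Submodule.span_le.mpr ?_
      rintro _ ⟨u, -, v, -, rfl⟩
      exact hBl u v k
    exact this hx
  have kB2 : ∀ h x, pK x = 0 → B h x = 0 := by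
    intro k x hx
    rw [← LinearMap.mem_ker, hkerK] at hx
    have : derived F K ≤ LinearMap.ker (B k) := by
      refine Submodule.span_le.mpr ?_
      rintro _ ⟨u, -, v, -, rfl⟩
      exact hBr k u v
    exact this hx
  have kB : ∀ h h' k k', pH h = pH h' → pK k = pK k' → B h k = B h' k' := by
    intro h h' k k' e1 e2
    have a1 := kB1 (h - h') k (by rw [map_sub, e1, sub_self])
    have a2 := kB2 h' (k - k') (by rw [map_sub, e2, sub_self])
    rw [map_sub, LinearMap.sub_apply, sub_eq_zero] at a1
    rw [map_sub, sub_eq_zero] at a2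
    rw [a1, a2]
  obtain ⟨s, hs⟩ := pH.exists_rightInverse_of_surjective (LinearMap.range_eq_top.mpr hpHs)
  obtain ⟨r, hr⟩ := pK.exists_rightInverse_of_surjective (LinearMap.range_eq_top.mpr hpKs)
  have hs' : ∀ x, pH (s x) = x := fun x => LinearMap.congr_fun hs x
  have hr' : ∀ x, pK (r x) = x := fun x => LinearMap.congr_fun hr x
  let D : QH →ₗ[F] QK →ₗ[F] E := B.compl₁₂ s r
  have Da : ∀ x y, D x y = B (s x) (r y) := fun _ _ => rfl
  have Dp : ∀ h k, D (pH h) (pK k) = B h k := fun h k => by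
    rw [Da]; exact kB _ _ _ _ (hs' _) (hr' _)
  have hD : TensorRel F (fun (_ : QH) (_ : QK) => (0 : QK))
      (fun (_ : QK) (_ : QH) => (0 : QH)) (fun x y => D x y) := by
    refine ⟨?_, ?_, ?_, ?_, ?_, ?_, ?_, ?_⟩
    · simp
    · simp
    · simp
    · simp
    · intro a b x hx y hy
      obtain ⟨h, hh, rfl⟩ := homog_lift hpH hpHs a x hx
      obtain ⟨k, hk, rfl⟩ := homog_lift hpK hpKs b y hy
      rw [Dp]
      exact T.grade a b _ (gl _ _ hh) _ (gr' _ _ hk)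
    · intro a b x hx y hy z
      obtain ⟨x, rfl⟩ := hpHs x
      obtain ⟨y, rfl⟩ := hpHs y
      obtain ⟨z, rfl⟩ := hpKs z
      rw [← hpH.2, Dp, hBl]
      simp
    · intro a b c x hx y hy z hz
      obtain ⟨x, rfl⟩ := hpHs x
      obtain ⟨y, rfl⟩ := hpKs y
      obtain ⟨z, rfl⟩ := hpKs z
      rw [← hpK.2, Dp, hBr]
      simp
    · intro a b x hx y hy z w
      obtain ⟨h, hh, rfl⟩ := homog_lift hpH hpHs a x hx
      obtain ⟨k, hk, rfl⟩ := homog_lift hpK hpKs b y hy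
      rw [Dp, Da z w, Ba, Ba, T.brk_brk a b _ (gl _ _ hh) _ (gr' _ _ hk), z2, T.zero_l]
      simp
  obtain ⟨l, ⟨l1, l2⟩, -⟩ := hTQ.lift' hD
  have lB0 : ∀ h k, l (B0 h k) = B h k := fun h k => by rw [B0a, l2, Dp]
  have lC : ∀ h k, l (C h k) = - t (0, k) (h, 0) := by
    intro h k
    refine homog_ind F (fun h => l (C h k) = - t (0, k) (h, 0)) ?_ ?_ h
    · intro a h hh
      refine homog_ind F (fun k => l (C h k) = - t (0, k) (h, 0)) ?_ ?_ k
      · intro b k hk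
        rw [hC a b h hh k hk, map_smul, lB0, Ba, hE.rel.alt b a _ (gr' _ _ hk) _ (gl _ _ hh),
          sg_comm' F b a]
        simp
      · intro u v hu hv
        have : ((0, u + v) : H × K) = (0, u) + (0, v) := by simp
        rw [map_add, map_add, hu, hv, this, T.add_left]
        abel
    · intro u v hu hv
      have : ((u + v, 0) : H × K) = (u, 0) + (v, 0) := by simp
      rw [map_add, LinearMap.add_apply, map_add, hu, hv, this, T.add_right]
      abel
  let ψ : EH × EK × TQ →ₗ[F] E := f.coprod (g.coprod l)
  have ψa : ∀ x y z, ψ (x, y, z) = f x + (g y + l z) := fun _ _ _ => rfl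
  have h1 : ψ ∘ₗ φ = LinearMap.id := by
    apply LinearMap.ext_on hE.span_top
    rintro _ ⟨⟨h, k⟩, ⟨h', k'⟩, rfl⟩
    rw [LinearMap.comp_apply, φ2, ψa, f2, g2, ca, map_sub, lB0, lC, Ba]
    simp only [LinearMap.fst_apply, LinearMap.snd_apply, LinearMap.inl_apply,
      LinearMap.inr_apply, LinearMap.id_apply]
    have e1 : ((h, k) : H × K) = (h, 0) + (0, k) := by simp
    have e2 : ((h', k') : H × K) = (h', 0) + (0, k') := by simp
    rw [e1, e2, T.add_left, T.add_right, T.add_right]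
    abel
  have jH := inl_hom F EH (EK × TQ)
  have jK := (inr_hom F EH (EK × TQ)).cmp (inl_hom F EK TQ)
  have jQ := (inr_hom F EH (EK × TQ)).cmp (inr_hom F EK TQ)
  have k1 : φ ∘ₗ f = LinearMap.inl F EH (EK × TQ) := by
    refine (hEH.lift' (hEH.rel.push jH)).unique ⟨φ1.cmp f1, fun x y => ?_⟩
      ⟨jH, fun _ _ => rfl⟩
    rw [LinearMap.comp_apply, f2, φ2, ca]
    simp [TK.zero_l]
  have k2 : φ ∘ₗ g = LinearMap.inr F EH (EK × TQ) ∘ₗ LinearMap.inl F EK TQ := by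
    refine (hEK.lift' (hEK.rel.push jK)).unique ⟨φ1.cmp g1, fun x y => ?_⟩
      ⟨jK, fun _ _ => rfl⟩
    rw [LinearMap.comp_apply, g2, φ2, ca]
    simp [TH.zero_l]
  have k3 : φ ∘ₗ l = LinearMap.inr F EH (EK × TQ) ∘ₗ LinearMap.inr F EK TQ := by
    refine (hTQ.lift' (hTQ.rel.push jQ)).unique ⟨φ1.cmp l1, fun x y => ?_⟩
      ⟨jQ, fun _ _ => rfl⟩
    rw [LinearMap.comp_apply, l2, Da, Ba, φ2, ca, B0a]
    simp [TH.zero_r, TK.zero_l, hs', hr']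
  have h2 : φ ∘ₗ ψ = LinearMap.id := by
    apply LinearMap.ext
    rintro ⟨x, y, z⟩
    have a1 := LinearMap.congr_fun k1 x
    have a2 := LinearMap.congr_fun k2 y
    have a3 := LinearMap.congr_fun k3 z
    simp only [LinearMap.comp_apply] at a1 a2 a3
    rw [LinearMap.comp_apply, ψa, map_add, map_add, a1, a2, a3]
    simp
  exact ⟨LinearEquiv.ofLinear φ ψ h2 h1, φ1⟩

end SuperLie
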